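/- Let f be a non-conformal harmonic map to S³ with frame data φ, μ, and let ε, ε̃ ∈ {1,-1} with εε̃ = -1. Then the composed transform satisfies (fᵉ)^ε̃ = f; in particular (f⁺)⁻ = (f⁻)⁺ = f. -/

import Mathlib

noncomputable section

/-- Partial derivative in the `x`-direction for maps on `ℂ ≅ ℝ²`. -/
def pX {E : Type*} [NormedAddCommGroup E] [NormedSpace ℝ E] (g : ℂ → E) (z : ℂ) : E :=
  fderiv ℝ g z 1

/-- Partial derivative in the `y`-direction for maps on `ℂ ≅ ℝ²`. -/
def pY {E : Type*} [NormedAddCommGroup E] [NormedSpace ℝ E] (g : ℂ → E) (z : ℂ) : E :=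
  fderiv ℝ g z Complex.I

/-- Euclidean inner product on the quaternions. -/
def qinner (p q : Quaternion ℝ) : ℝ := (p * star q).re

/-- Cross product of imaginary quaternions: `a × b = (ab - ba)/2`. -/
def qcross (a b : Quaternion ℝ) : Quaternion ℝ := (2 : ℝ)⁻¹ • (a * b - b * a)

/-- The `ε`-transform `fᵉ = (1/2) sech²φ · f (εβ + (1/2) α×β)` of a non-conformal harmonic
map `f : S → S³ ⊂ ℍ` with adapted coordinate, where `∂f = (1/2) f(α - iβ)`,
i.e. `f_x = fα`, `f_y = fβ`. -/
def transform (ε : ℝ) (φ : ℂ → ℝ) (f α β : ℂ → Quaternion ℝ) : ℂ → Quaternion ℝ :=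
  fun z => ((2 : ℝ)⁻¹ * ((Real.cosh (φ z))⁻¹) ^ 2) •
    (f z * (ε • β z + (2 : ℝ)⁻¹ • qcross (α z) (β z)))

theorem aux_sq (a : Quaternion ℝ) (h : a.re = 0) : a * a = -(‖a‖ ^ 2) • (1 : Quaternion ℝ) := by
  have h1 : star a = -a := by
    ext <;> simp [h]
  have h2 : a * star a = ((Quaternion.normSq a : ℝ) : Quaternion ℝ) := Quaternion.self_mul_star a
  rw [h1, Quaternion.normSq_eq_norm_mul_self] at h2
  have h3 : a * a = -((‖a‖ * ‖a‖ : ℝ) : Quaternion ℝ) := by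
    rw [← h2]; simp
  rw [h3, neg_smul, ← pow_two]
  rw [← Quaternion.coe_mul_eq_smul, mul_one]

theorem aux_anti (a b : Quaternion ℝ) (ha : a.re = 0) (hb : b.re = 0) (h : (a * b).re = 0) :
    b * a = -(a * b) := by
  have h1 := h
  rw [Quaternion.re_mul] at h1
  ext <;> simp only [Quaternion.re_mul, Quaternion.imI_mul, Quaternion.imJ_mul,
    Quaternion.imK_mul, Quaternion.re_neg, Quaternion.imI_neg, Quaternion.imJ_neg,
    Quaternion.imK_neg, ha, hb] at h1 ⊢ <;> linarith

theorem aux_inner (a b : Quaternion ℝ) (hb : b.re = 0) (h : qinner a b = 0) :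
    (a * b).re = 0 := by
  have h1 : star b = -b := by
    ext <;> simp [hb]
  unfold qinner at h
  rw [h1, mul_neg, Quaternion.re_neg] at h
  linarith

theorem aux_cross (a b : Quaternion ℝ) (h : b * a = -(a * b)) : qcross a b = a * b := by
  unfold qcross
  rw [h]
  module

theorem pX_mul (g h : ℂ → Quaternion ℝ) (z : ℂ) (hg : DifferentiableAt ℝ g z)
    (hh : DifferentiableAt ℝ h z) :
    pX (fun w => g w * h w) z = pX g z * h z + g z * pX h z := by
  unfold pX
  rw [fderiv_fun_mul' hg hh]
  simp [add_comm]

theorem pY_mul (g h : ℂ → Quaternion ℝ) (z : ℂ) (hg : DifferentiableAt ℝ g z)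
    (hh : DifferentiableAt ℝ h z) :
    pY (fun w => g w * h w) z = pY g z * h z + g z * pY h z := by
  unfold pY
  rw [fderiv_fun_mul' hg hh]
  simp [add_comm]

theorem pXY_symm (f : ℂ → Quaternion ℝ) (hf : ContDiff ℝ (⊤ : ℕ∞) f) (z : ℂ) :
    pX (pY f) z = pY (pX f) z := by
  have hd : DifferentiableAt ℝ (fderiv ℝ f) z :=
    ((hf.fderiv_right (m := 1) (by norm_cast)).differentiable (by norm_num)) z
  have hs : IsSymmSndFDerivAt ℝ f z :=
    (hf.contDiffAt).isSymmSndFDerivAt (by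
      rw [minSmoothness_of_isRCLikeNormedField]
      exact WithTop.coe_le_coe.mpr (le_top : (2 : ℕ∞) ≤ ⊤))
  have key : ∀ v w : ℂ, fderiv ℝ (fun u => fderiv ℝ f u v) z w = fderiv ℝ (fderiv ℝ f) z w v := by
    intro v w
    rw [fderiv_clm_apply hd (by fun_prop)]
    simp
  change fderiv ℝ (fun u => fderiv ℝ f u Complex.I) z 1 = fderiv ℝ (fun u => fderiv ℝ f u 1) z Complex.I
  rw [key, key]
  exact hs _ _

/-- `ν = k (ε β + αβ/2)`: the algebra of the transform. -/
theorem aux_nu (ε c s k : ℝ) (hε : ε = 1 ∨ ε = -1) (hc : 0 < c) (hcs : c ^ 2 = s ^ 2 + 1)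
    (hk : k * (2 * c ^ 2) = 1)
    (a b : Quaternion ℝ) (hab : b * a = -(a * b))
    (ha : a * a = -((2 * s) ^ 2) • (1 : Quaternion ℝ))
    (hb : b * b = -((2 * c) ^ 2) • (1 : Quaternion ℝ))
    (ν : Quaternion ℝ) (hν : ν = k • (ε • b + (2 : ℝ)⁻¹ • (a * b))) :
    ν * b = -((2 * ε) • (1 : Quaternion ℝ) + a) ∧ ν * ((2 * ε) • (1 : Quaternion ℝ) + a) = b ∧
    ν * ν = -1 := by
  have hε2 : ε ^ 2 = 1 := by rcases hε with h | h <;> rw [h] <;> norm_num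
  have h1 : ν * b = -((2 * ε) • (1 : Quaternion ℝ) + a) := by
    rw [hν, smul_mul_assoc, add_mul, smul_mul_assoc, smul_mul_assoc, mul_assoc, hb, mul_smul_comm,
      mul_one]
    match_scalars
    · linear_combination (-2 * ε) * hk
    · linear_combination (-1) * hk
  have h2 : ν * ((2 * ε) • (1 : Quaternion ℝ) + a) = b := by
    rw [hν, mul_add, mul_smul_comm, mul_one, smul_mul_assoc, add_mul, smul_mul_assoc,
      smul_mul_assoc, mul_assoc, hab, mul_neg, ← mul_assoc, ha, smul_mul_assoc, one_mul]
    match_scalars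
    · linear_combination hk + 2 * k * hε2 - 2 * k * hcs
    · ring
  refine ⟨h1, h2, ?_⟩
  have h3 : (ν * ν) * (b * b) = -(b * b) := by
    rw [← mul_assoc, mul_assoc ν ν b, h1, mul_neg, h2, neg_mul]
  rw [hb, mul_smul_comm, mul_one, ← smul_neg] at h3
  have h4 : -((2 * c) ^ 2) ≠ 0 := by
    have : 0 < (2 * c) ^ 2 := by positivity
    linarith
  exact smul_right_injective _ h4 h3

/-- Final algebra step. -/
theorem aux_final (ε C S : ℝ) (hε : ε = 1 ∨ ε = -1) (hC : 0 < C) (hCS : C ^ 2 = S ^ 2 + 1)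
    (ν a b : Quaternion ℝ) (hνν : ν * ν = -1) (hνre : ν.re = 0) (ha : a.re = 0) (hb : b.re = 0)
    (haa : a * a = -((2 * S) ^ 2) • (1 : Quaternion ℝ))
    (hbe : b = (2 * ε) • ν - ν * a) (F : Quaternion ℝ) :
    ((2 : ℝ)⁻¹ * (C⁻¹) ^ 2) • (F * ν * ((-ε) • b + (2 : ℝ)⁻¹ • (a * b))) = F := by
  have hε2 : ε ^ 2 = 1 := by rcases hε with h | h <;> rw [h] <;> norm_num
  have h1 : (ν * a).re = 0 := by
    have := congrArg (fun q : Quaternion ℝ => q.re) hbe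
    simp only [Quaternion.re_sub, Quaternion.re_smul, hb, hνre, smul_zero] at this
    linarith
  have h2 : a * ν = -(ν * a) := aux_anti ν a hνre ha h1
  have h3 : a * b = -(2 * ε) • (ν * a) - ((2 * S) ^ 2) • ν := by
    rw [hbe, mul_sub, mul_smul_comm, h2, ← mul_assoc, h2, neg_mul, mul_assoc, haa, mul_smul_comm,
      mul_one]
    module
  have h4 : (-ε) • b + (2 : ℝ)⁻¹ • (a * b) = (-(2 * C ^ 2)) • ν := by
    rw [h3, hbe]
    match_scalars
    · linear_combination (-2) * hε2 + 2 * hCS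
    · ring
  rw [h4, mul_smul_comm, mul_assoc, hνν, smul_smul]
  have h5 : ((2 : ℝ)⁻¹ * (C⁻¹) ^ 2) * (-(2 * C ^ 2)) = -1 := by field_simp
  rw [h5]
  simp

/-- The `(+)`transform and `(-)`transform of a non-conformal harmonic map `f : S → S³` are
mutual inverses: for `ε ε̃ = -1` one has `(fᵉ)^ε̃ = f`; in particular
`(f⁺)⁻ = (f⁻)⁺ = f`. -/
theorem transform_inverse (ε εt : ℝ) (hε : ε = 1 ∨ ε = -1) (hεt : εt = -ε)
    (f α β : ℂ → Quaternion ℝ) (φ : ℂ → ℝ)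
    (hsf : ContDiff ℝ (⊤ : ℕ∞) f) (hsα : ContDiff ℝ (⊤ : ℕ∞) α) (hsβ : ContDiff ℝ (⊤ : ℕ∞) β)
    (hsφ : ContDiff ℝ (⊤ : ℕ∞) φ)
    (hunit : ∀ z, ‖f z‖ = 1)
    (hαim : ∀ z, (α z).re = 0) (hβim : ∀ z, (β z).re = 0)
    (hfx : ∀ z, pX f z = f z * α z) (hfy : ∀ z, pY f z = f z * β z)
    (hφpos : ∀ z, 0 < φ z)
    (hαn : ∀ z, ‖α z‖ = 2 * Real.sinh (φ z)) (hβn : ∀ z, ‖β z‖ = 2 * Real.cosh (φ z))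
    (hαβ : ∀ z, qinner (α z) (β z) = 0)
    (hharm : ∀ z, pX (pX f) z + pY (pY f) z = -(‖pX f z‖ ^ 2 + ‖pY f z‖ ^ 2) • f z)
    -- the data of the transformed map fᵉ = transform ε φ f α β
    (αe βe : ℂ → Quaternion ℝ) (φe : ℂ → ℝ)
    (hαeim : ∀ z, (αe z).re = 0) (hβeim : ∀ z, (βe z).re = 0)
    (hfex : ∀ z, pX (transform ε φ f α β) z = transform ε φ f α β z * αe z)
    (hfey : ∀ z, pY (transform ε φ f α β) z = transform ε φ f α β z * βe z)
    (hφepos : ∀ z, 0 ≤ φe z)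
    (hαen : ∀ z, ‖αe z‖ = 2 * Real.sinh (φe z))
    (hβen : ∀ z, ‖βe z‖ = 2 * Real.cosh (φe z))
    (hαeβe : ∀ z, qinner (αe z) (βe z) = 0) :
    ∀ z, transform εt φe (transform ε φ f α β) αe βe z = f z := by
  have hε2 : ε ^ 2 = 1 := by rcases hε with h | h <;> rw [h] <;> norm_num
  have hdf : Differentiable ℝ f := hsf.differentiable (by simp)
  have hdα : Differentiable ℝ α := hsα.differentiable (by simp)
  have hdβ : Differentiable ℝ β := hsβ.differentiable (by simp)
  have hdφ : Differentiable ℝ φ := hsφ.differentiable (by simp)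
  have hanti : ∀ z, β z * α z = -(α z * β z) := fun z =>
    aux_anti _ _ (hαim z) (hβim z) (aux_inner _ _ (hβim z) (hαβ z))
  have hαα : ∀ z, α z * α z = -((2 * Real.sinh (φ z)) ^ 2) • (1 : Quaternion ℝ) := fun z => by
    rw [aux_sq _ (hαim z), hαn]
  have hββ : ∀ z, β z * β z = -((2 * Real.cosh (φ z)) ^ 2) • (1 : Quaternion ℝ) := fun z => by
    rw [aux_sq _ (hβim z), hβn]
  obtain ⟨ν, hν⟩ : ∃ ν : ℂ → Quaternion ℝ, ν = fun z =>
    ((2 : ℝ)⁻¹ * ((Real.cosh (φ z))⁻¹) ^ 2) • (ε • β z + (2 : ℝ)⁻¹ • (α z * β z)) := ⟨_, rfl⟩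
  have hT : transform ε φ f α β = fun z => f z * ν z := by
    funext z
    unfold transform
    rw [aux_cross _ _ (hanti z), hν, mul_smul_comm]
  have hdν : Differentiable ℝ ν := by
    intro z
    rw [hν]
    have hc : Real.cosh (φ z) ≠ 0 := (Real.cosh_pos _).ne'
    have h0 : DifferentiableAt ℝ (fun z => (Real.cosh (φ z))⁻¹) z :=
      ((hdφ z).cosh).inv hc
    have h1 : DifferentiableAt ℝ (fun z => (2 : ℝ)⁻¹ * ((Real.cosh (φ z))⁻¹) ^ 2) z :=
      (h0.pow 2).const_mul _
    exact h1.smul (((hdβ z).fun_const_smul ε).fun_add (((hdα z).fun_mul (hdβ z)).fun_const_smul _))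
  have hνall : ∀ z, ν z * β z = -((2 * ε) • (1 : Quaternion ℝ) + α z) ∧
      ν z * ((2 * ε) • (1 : Quaternion ℝ) + α z) = β z ∧ ν z * ν z = -1 := fun z =>
    aux_nu ε (Real.cosh (φ z)) (Real.sinh (φ z)) ((2 : ℝ)⁻¹ * ((Real.cosh (φ z))⁻¹) ^ 2) hε (Real.cosh_pos _) (Real.cosh_sq _)
      (by have := (Real.cosh_pos (φ z)).ne'; field_simp) (α z) (β z) (hanti z) (hαα z) (hββ z) (ν z)
      (by rw [hν])
  have hfne : ∀ z, f z ≠ 0 := fun z h => by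
    have := hunit z
    rw [h] at this
    simp at this
  intro z
  -- structure equations
  have hfX : pX f = fun w => f w * α w := funext hfx
  have hfY : pY f = fun w => f w * β w := funext hfy
  have hint : β z * α z + pY α z = α z * β z + pX β z := by
    have h := pXY_symm f hsf z
    rw [hfX, hfY, pX_mul _ _ _ (hdf z) (hdβ z), pY_mul _ _ _ (hdf z) (hdα z), hfx, hfy] at h
    apply mul_left_cancel₀ (hfne z)
    rw [mul_add, mul_add, ← mul_assoc, ← mul_assoc]
    exact h.symm
  have hha : pX α z + pY β z = 0 := by
    have h := hharm z
    rw [hfx z, hfy z, hfX, hfY, pX_mul _ _ _ (hdf z) (hdα z), pY_mul _ _ _ (hdf z) (hdβ z),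
      hfx, hfy, mul_assoc, mul_assoc, aux_sq _ (hαim z), aux_sq _ (hβim z), norm_mul, norm_mul,
      hunit z, one_mul, one_mul, mul_smul_comm, mul_smul_comm, mul_one] at h
    apply mul_left_cancel₀ (hfne z)
    rw [mul_add, mul_zero]
    have h' : f z * pX α z + f z * pY β z = (-‖α z‖ ^ 2 • f z + f z * pX α z +
      (-‖β z‖ ^ 2 • f z + f z * pY β z)) - (-(‖α z‖ ^ 2 + ‖β z‖ ^ 2) • f z) := by module
    rw [h', sub_eq_zero]
    convert h using 2
  -- derivatives of ν * β
  have hνβ : (fun w => ν w * β w) = fun w => -((2 * ε) • (1 : Quaternion ℝ) + α w) :=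
    funext fun w => (hνall w).1
  have hνX : pX ν z * β z + ν z * pX β z = - pX α z := by
    rw [← pX_mul _ _ _ (hdν z) (hdβ z), hνβ]
    simp [pX]
  have hνY : pY ν z * β z + ν z * pY β z = - pY α z := by
    rw [← pY_mul _ _ _ (hdν z) (hdβ z), hνβ]
    simp [pY]
  have hex : α z * ν z + pX ν z = ν z * αe z := by
    have h := hfex z
    rw [hT, pX_mul _ _ _ (hdf z) (hdν z), hfx] at h
    apply mul_left_cancel₀ (hfne z)
    rw [mul_add, ← mul_assoc, ← mul_assoc]
    exact h
  have hey : β z * ν z + pY ν z = ν z * βe z := by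
    have h := hfey z
    rw [hT, pY_mul _ _ _ (hdf z) (hdν z), hfy] at h
    apply mul_left_cancel₀ (hfne z)
    rw [mul_add, ← mul_assoc, ← mul_assoc]
    exact h
  obtain ⟨n1, n2, n3⟩ := hνall z
  have hβne : β z ≠ 0 := by
    intro h
    have := hβn z
    rw [h, norm_zero] at this
    have := Real.cosh_pos (φ z)
    linarith
  have hνre : (ν z).re = 0 := by
    have h1 := aux_inner _ _ (hβim z) (hαβ z)
    rw [hν]
    simp only [Quaternion.re_smul, Quaternion.re_add, h1, hβim z]
    simp
  have hanti' := hanti z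
  have hbe : βe z = (2 * ε) • ν z - ν z * αe z := by
    have hane : ν z ≠ 0 := by
      intro h; rw [h] at n3; simp at n3
    apply mul_left_cancel₀ hane
    apply mul_right_cancel₀ hβne
    -- α_e β and ν β_e β
    have e1 : ν z * αe z * β z = α z * (ν z * β z) + (- pX α z - ν z * pX β z) := by
      rw [← hex, ← hνX]; noncomm_ring
    have e2 : ν z * βe z * β z = β z * (ν z * β z) + (- pY α z - ν z * pY β z) := by
      rw [← hey, ← hνY]; noncomm_ring
    have e3 : ν z * ((2 * ε) • ν z - ν z * αe z) * β z
        = (2 * ε) • (ν z * ν z * β z) - ν z * (ν z * αe z * β z) := by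
      rw [mul_sub, mul_smul_comm, sub_mul, smul_mul_assoc]
      simp only [mul_assoc]
    have e4 : pY β z = - pX α z := by
      rw [eq_neg_iff_add_eq_zero, add_comm]; exact hha
    have e5 : pY α z = α z * β z + pX β z - β z * α z := by
      rw [← hint]; abel
    have n4 : ν z * ν z * pX β z = - pX β z := by rw [n3]; simp
    have n5 : ν z * (α z * ((2 * ε) • (1 : Quaternion ℝ) + α z)) = β z * α z := by
      rw [← n2, mul_assoc]
      congr 1
      rw [mul_add, add_mul]; simp
    rw [e3, e1, e2, e4, n3, e5, n1]
    have e6 : ν z * (α z * -((2 * ε) • (1 : Quaternion ℝ) + α z) + (-pX α z - ν z * pX β z))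
       = -(β z * α z) - ν z * pX α z + pX β z := by
      rw [mul_neg, mul_add, mul_neg, n5, mul_sub, ← mul_assoc (ν z) (ν z), n4]
      simp only [mul_neg]; abel
    rw [e6, hanti', mul_neg, mul_neg, mul_add, mul_smul_comm, mul_one, hanti', neg_one_mul]
    module
  have habe : αe z * βe z = qcross (αe z) (βe z) :=
    (aux_cross _ _ (aux_anti _ _ (hαeim z) (hβeim z)
      (aux_inner _ _ (hβeim z) (hαeβe z)))).symm
  have hTz : transform ε φ f α β z = f z * ν z := by rw [hT]
  have hgoal : transform εt φe (transform ε φ f α β) αe βe z =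
      ((2 : ℝ)⁻¹ * ((Real.cosh (φe z))⁻¹) ^ 2) •
      (transform ε φ f α β z * (εt • βe z + (2 : ℝ)⁻¹ • qcross (αe z) (βe z))) := rfl
  rw [hgoal, hTz, ← habe, hεt]
  exact aux_final ε _ (Real.sinh (φe z)) hε (Real.cosh_pos _) (Real.cosh_sq _) (ν z) (αe z) (βe z)
    n3 hνre (hαeim z) (hβeim z) (by rw [aux_sq _ (hαeim z), hαen]) hbe (f z)
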